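/- Every element of L_2(ℂ⟨x,y⟩) is congruent modulo L_3(ℂ⟨x,y⟩) to a finite ℂ-linear combination of commutators [x^i, y^j] with integers i, j ≥ 1; that is, the classes of the elements [x^i, y^j] (i, j ≥ 1) span B_2(ℂ⟨x,y⟩) as a ℂ-vector space. -/

import Mathlib

noncomputable section

/-- The free associative unital ℂ-algebra on two generators x, y. -/
abbrev F2 : Type := FreeAlgebra ℂ (Fin 2)

/-- Lower central series: `lcs A i` is `L_{i+1}(A)`. -/
def lcs (A : Type) [Ring A] [Algebra ℂ A] : ℕ → Submodule ℂ A
  | 0 => ⊤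
  | n + 1 => Submodule.span ℂ {x | ∃ a u, u ∈ lcs A n ∧ x = a * u - u * a}

/-- L₃(A) viewed as a submodule of L₂(A). -/
def L3sub (A : Type) [Ring A] [Algebra ℂ A] : Submodule ℂ ↥(lcs A 1) :=
  (lcs A 2).comap (lcs A 1).subtype

/-- B₂(A) = L₂(A)/L₃(A). -/
abbrev B2 (A : Type) [Ring A] [Algebra ℂ A] : Type := ↥(lcs A 1) ⧸ L3sub A

/-- A bilinear pairing on an algebra with the formal properties of the commutator pairing
`(a, b) ↦ [a, b]` modulo `L₃`. -/
structure IsCyclicPairing {A B : Type} [Ring A] [Algebra ℂ A] [AddCommGroup B] [Module ℂ B]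
    (ω : A →ₗ[ℂ] A →ₗ[ℂ] B) : Prop where
  skew : ∀ a b, ω a b = - ω b a
  cyclic : ∀ a b c, ω (a * b) c + ω (b * c) a + ω (c * a) b = 0
  comm_right : ∀ a b c, ω a (b * c - c * b) = 0

namespace IsCyclicPairing

section General

variable {A B : Type} [Ring A] [Algebra ℂ A] [AddCommGroup B] [Module ℂ B]
  {ω : A →ₗ[ℂ] A →ₗ[ℂ] B}

theorem comm_left (h : IsCyclicPairing ω) (a b c : A) : ω (b * c - c * b) a = 0 := by
  rw [h.skew, h.comm_right, neg_zero]

theorem mul_comm_right (h : IsCyclicPairing ω) (a b c : A) : ω a (b * c) = ω a (c * b) := by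
  rw [← sub_eq_zero, ← map_sub, h.comm_right]

theorem apply_mul (h : IsCyclicPairing ω) (a b c : A) :
    ω a (b * c) = ω (a * b) c + ω (c * a) b := by
  have h1 := h.cyclic a b c
  rw [h.skew (b * c) a] at h1
  rw [← sub_eq_zero, ← neg_eq_zero, ← h1]
  abel

theorem apply_one (h : IsCyclicPairing ω) (a : A) : ω a 1 = 0 := by
  have h1 := h.apply_mul a 1 1
  simpa using h1

theorem apply_algebraMap (h : IsCyclicPairing ω) (a : A) (r : ℂ) :
    ω a (algebraMap ℂ A r) = 0 := by
  rw [Algebra.algebraMap_eq_smul_one, map_smul, h.apply_one, smul_zero]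

theorem quad_swap_middle (a b c d : A) :
    ω (a * (b * c - c * b)) d = - ω (a * (c * b - b * c)) d := by
  rw [← neg_sub (c * b), mul_neg, map_neg, LinearMap.neg_apply]

theorem quad_swap_left (h : IsCyclicPairing ω) (a b c d : A) :
    ω (a * (b * c - c * b)) d = - ω (b * (a * c - c * a)) d := by
  have e : a * (b * c - c * b) = ((a * b) * c - c * (a * b)) - b * (a * c - c * a)
      - ((a * c - c * a) * b - b * (a * c - c * a)) := by noncomm_ring
  rw [e, map_sub, map_sub, LinearMap.sub_apply, LinearMap.sub_apply, h.comm_left, h.comm_left]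
  abel

theorem quad_swap_outer (h : IsCyclicPairing ω) (a b c d : A) :
    ω (a * (b * c - c * b)) d = - ω (d * (b * c - c * b)) a := by
  have h1 := h.cyclic a (b * c - c * b) d
  have e : (b * c - c * b) * d = d * (b * c - c * b)
      + ((b * c - c * b) * d - d * (b * c - c * b)) := by abel
  rw [h.comm_right, e, map_add, LinearMap.add_apply, h.comm_left, add_zero, add_zero] at h1
  exact eq_neg_of_add_eq_zero_left h1

theorem quad_mul (h : IsCyclicPairing ω) (a b c d e : A) :
    ω (a * (b * (c * d) - (c * d) * b)) e =
      ω ((a * c) * (b * d - d * b)) e + ω ((d * a) * (b * c - c * b)) e := by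
  have e : a * (b * (c * d) - (c * d) * b) = (a * c) * (b * d - d * b)
      + (d * a) * (b * c - c * b)
      + ((a * (b * c - c * b)) * d - d * (a * (b * c - c * b))) := by noncomm_ring
  rw [e, map_add, map_add, LinearMap.add_apply, LinearMap.add_apply, h.comm_left, add_zero]

theorem quad_swap_right (h : IsCyclicPairing ω) (a b c d : A) :
    ω (a * (b * c - c * b)) d = - ω (a * (b * d - d * b)) c := by
  rw [quad_swap_middle, h.quad_swap_left, h.quad_swap_outer, h.quad_swap_left, quad_swap_middle]
  abel

theorem pow_succ_apply (h : IsCyclicPairing ω) (g : A) (n : ℕ) (b : A) :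
    ω (g ^ (n + 1)) b = ((n : ℂ) + 1) • ω g (g ^ n * b) := by
  induction n generalizing b with
  | zero => simp
  | succ n ih =>
    have h1 := h.cyclic g (g ^ (n + 1)) b
    rw [h.skew (g ^ (n + 1) * b), h.skew (b * g), h.mul_comm_right _ b g, ih, ← pow_succ',
      ← mul_assoc (g ^ n), ← pow_succ] at h1
    rw [← sub_eq_zero, ← h1]
    push_cast
    module

end General

variable {B : Type} [AddCommGroup B] [Module ℂ B] {ω : F2 →ₗ[ℂ] F2 →ₗ[ℂ] B}

theorem quad_eq_zero_of_generators (h : IsCyclicPairing ω) (b d : F2)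
    (hg : ∀ a i, ω (a * (b * FreeAlgebra.ι ℂ i - FreeAlgebra.ι ℂ i * b)) d = 0) (a c : F2) :
    ω (a * (b * c - c * b)) d = 0 := by
  induction c using FreeAlgebra.induction generalizing a with
  | grade0 r => simp [Algebra.commutes r b]
  | grade1 i => exact hg a i
  | mul c c' hc hc' => rw [h.quad_mul, hc, hc', add_zero]
  | add c c' hc hc' =>
    have e : a * (b * (c + c') - (c + c') * b) =
        a * (b * c - c * b) + a * (b * c' - c' * b) := by noncomm_ring
    rw [e, map_add, LinearMap.add_apply, hc, hc', add_zero]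

/-- With only two generators, an alternating form in three generators vanishes. -/
theorem quad_generators (h : IsCyclicPairing ω) (a : F2) (i j k : Fin 2) :
    ω (a * (FreeAlgebra.ι ℂ i * FreeAlgebra.ι ℂ j - FreeAlgebra.ι ℂ j * FreeAlgebra.ι ℂ i))
      (FreeAlgebra.ι ℂ k) = 0 := by
  have key : ∀ i k : Fin 2,
      ω (a * (FreeAlgebra.ι ℂ i * FreeAlgebra.ι ℂ i - FreeAlgebra.ι ℂ i * FreeAlgebra.ι ℂ i))
        (FreeAlgebra.ι ℂ k) = 0 := by
    intro i k
    simp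
  have hijk : i = j ∨ k = i ∨ k = j := by omega
  rcases hijk with rfl | rfl | rfl
  · exact key _ _
  · rw [h.quad_swap_right, key, neg_zero]
  · rw [quad_swap_middle, h.quad_swap_right, key, neg_zero, neg_zero]

theorem quad_eq_zero (h : IsCyclicPairing ω) (a b c d : F2) :
    ω (a * (b * c - c * b)) d = 0 := by
  refine h.quad_eq_zero_of_generators b d (fun a i => ?_) a c
  rw [h.quad_swap_right, neg_eq_zero]
  refine h.quad_eq_zero_of_generators b _ (fun a j => ?_) a d
  rw [quad_swap_middle, neg_eq_zero]
  refine h.quad_eq_zero_of_generators _ _ (fun a k => ?_) a b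
  exact h.quad_generators a _ _ _

end IsCyclicPairing

/-- The left ideal generated by all commutators, as a `ℂ`-subspace. -/
def commIdeal (A : Type) [Ring A] [Algebra ℂ A] : Submodule ℂ A :=
  Submodule.span ℂ {w | ∃ a b c : A, w = a * (b * c - c * b)}

theorem mul_mem_commIdeal {A : Type} [Ring A] [Algebra ℂ A] (a : A) {w : A}
    (hw : w ∈ commIdeal A) : a * w ∈ commIdeal A := by
  induction hw using Submodule.span_induction with
  | mem w hw =>
    obtain ⟨a', b, c, rfl⟩ := hw
    exact Submodule.subset_span ⟨a * a', b, c, (mul_assoc _ _ _).symm⟩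
  | zero => simp
  | add u v _ _ hu hv => rw [mul_add]; exact add_mem hu hv
  | smul r u _ hu => rw [mul_smul_comm]; exact Submodule.smul_mem _ r hu

/-- Every element of `ℂ⟨x,y⟩` is a combination of ordered monomials modulo commutators. -/
theorem mem_span_monomials_sup_commIdeal (w : F2) :
    w ∈ Submodule.span ℂ {m : F2 | ∃ i j : ℕ,
        m = FreeAlgebra.ι ℂ (0 : Fin 2) ^ i * FreeAlgebra.ι ℂ (1 : Fin 2) ^ j} ⊔ commIdeal F2 := by
  set S := Submodule.span ℂ {m : F2 | ∃ i j : ℕ,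
        m = FreeAlgebra.ι ℂ (0 : Fin 2) ^ i * FreeAlgebra.ι ℂ (1 : Fin 2) ^ j}
  have hmon : ∀ i j : ℕ,
      FreeAlgebra.ι ℂ (0 : Fin 2) ^ i * FreeAlgebra.ι ℂ (1 : Fin 2) ^ j ∈ S ⊔ commIdeal F2 :=
    fun i j => Submodule.mem_sup_left (Submodule.subset_span ⟨i, j, rfl⟩)
  have hgen : ∀ (k : Fin 2) (i j : ℕ), FreeAlgebra.ι ℂ k *
      (FreeAlgebra.ι ℂ (0 : Fin 2) ^ i * FreeAlgebra.ι ℂ (1 : Fin 2) ^ j) ∈ S ⊔ commIdeal F2 := by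
    intro k i j
    fin_cases k
    · simpa [← mul_assoc, ← pow_succ'] using hmon (i + 1) j
    · have hc : ∀ a b c : F2, a * (b * c - c * b) ∈ S ⊔ commIdeal F2 :=
        fun a b c => Submodule.mem_sup_right (Submodule.subset_span ⟨a, b, c, rfl⟩)
      have e : ∀ u v z : F2, v * (u * z) = u * (v * z) + z * (v * u - u * v)
          + 1 * ((v * u - u * v) * z - z * (v * u - u * v)) := by
        intro u v z
        noncomm_ring
      show FreeAlgebra.ι ℂ (1 : Fin 2) * _ ∈ _
      rw [e, ← pow_succ']
      exact add_mem (add_mem (hmon _ _) (hc _ _ _)) (hc _ _ _)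
  have hmul : ∀ a, ∀ w ∈ S ⊔ commIdeal F2, a * w ∈ S ⊔ commIdeal F2 := by
    intro a
    induction a using FreeAlgebra.induction with
    | grade0 r =>
      intro w hw
      rw [← Algebra.smul_def]
      exact Submodule.smul_mem _ r hw
    | grade1 k =>
      intro w hw
      obtain ⟨s, hs, t, ht, rfl⟩ := Submodule.mem_sup.1 hw
      rw [mul_add]
      refine add_mem ?_ (Submodule.mem_sup_right (mul_mem_commIdeal _ ht))
      have hle : S ≤ (S ⊔ commIdeal F2).comap (LinearMap.mulLeft ℂ (FreeAlgebra.ι ℂ k)) := by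
        refine Submodule.span_le.2 ?_
        rintro _ ⟨i, j, rfl⟩
        exact hgen k i j
      exact hle hs
    | mul a b ha hb =>
      intro w hw
      rw [mul_assoc]
      exact ha _ (hb _ hw)
    | add a b ha hb =>
      intro w hw
      rw [add_mul]
      exact add_mem (ha _ hw) (hb _ hw)
  simpa using hmul w 1 (by simpa using hmon 0 0)

namespace IsCyclicPairing

variable {B : Type} [AddCommGroup B] [Module ℂ B] {ω : F2 →ₗ[ℂ] F2 →ₗ[ℂ] B}

theorem apply_generator_mem (h : IsCyclicPairing ω) {N : Submodule ℂ B}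
    (hN : ∀ i j : ℕ, 1 ≤ i → 1 ≤ j →
      ω (FreeAlgebra.ι ℂ (0 : Fin 2) ^ i) (FreeAlgebra.ι ℂ (1 : Fin 2) ^ j) ∈ N)
    (w : F2) (k : Fin 2) : ω w (FreeAlgebra.ι ℂ k) ∈ N := by
  have hpow : ∀ (g b : F2) (n : ℕ), ω (g ^ (n + 1)) b ∈ N → ω (g ^ n * b) g ∈ N := by
    intro g b n hb
    rw [h.pow_succ_apply] at hb
    rw [h.skew]
    exact neg_mem ((Submodule.smul_mem_iff N (Nat.cast_add_one_ne_zero n)).1 hb)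
  have hmon : ∀ i j : ℕ, ω (FreeAlgebra.ι ℂ (0 : Fin 2) ^ i * FreeAlgebra.ι ℂ (1 : Fin 2) ^ j)
      (FreeAlgebra.ι ℂ k) ∈ N := by
    intro i j
    fin_cases k
    · apply hpow
      rcases Nat.eq_zero_or_pos j with rfl | hj
      · rw [pow_zero, h.apply_one]
        exact zero_mem N
      · exact hN _ _ (Nat.succ_pos i) hj
    · show ω _ (FreeAlgebra.ι ℂ (1 : Fin 2)) ∈ N
      rw [h.skew, h.mul_comm_right, ← h.skew]
      apply hpow
      rw [h.skew]
      rcases Nat.eq_zero_or_pos i with rfl | hi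
      · rw [pow_zero, ← h.skew, h.apply_one]
        exact zero_mem N
      · exact neg_mem (hN _ _ hi (Nat.succ_pos j))
  have hle : Submodule.span ℂ {m : F2 | ∃ i j : ℕ,
        m = FreeAlgebra.ι ℂ (0 : Fin 2) ^ i * FreeAlgebra.ι ℂ (1 : Fin 2) ^ j} ⊔ commIdeal F2
      ≤ N.comap (ω.flip (FreeAlgebra.ι ℂ k)) := by
    refine sup_le (Submodule.span_le.2 ?_) (Submodule.span_le.2 ?_)
    · rintro _ ⟨i, j, rfl⟩
      exact hmon i j
    · rintro _ ⟨a, b, c, rfl⟩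
      show ω _ _ ∈ N
      rw [h.quad_eq_zero]
      exact zero_mem N
  exact hle (mem_span_monomials_sup_commIdeal w)

theorem apply_mem (h : IsCyclicPairing ω) {N : Submodule ℂ B}
    (hN : ∀ i j : ℕ, 1 ≤ i → 1 ≤ j →
      ω (FreeAlgebra.ι ℂ (0 : Fin 2) ^ i) (FreeAlgebra.ι ℂ (1 : Fin 2) ^ j) ∈ N)
    (a b : F2) : ω a b ∈ N := by
  induction b using FreeAlgebra.induction generalizing a with
  | grade0 r =>
    rw [h.apply_algebraMap]
    exact zero_mem N
  | grade1 k => exact h.apply_generator_mem hN a k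
  | mul b c hb hc =>
    rw [h.apply_mul]
    exact add_mem (hc _) (hb _)
  | add b c hb hc =>
    rw [map_add]
    exact add_mem (hb _) (hc _)

end IsCyclicPairing

theorem commutator_mem_lcs_one {A : Type} [Ring A] [Algebra ℂ A] (a b : A) :
    a * b - b * a ∈ lcs A 1 :=
  Submodule.subset_span ⟨a, b, Submodule.mem_top, rfl⟩

/-- The commutator pairing with values in `B₂(A)`. -/
def commPairing (A : Type) [Ring A] [Algebra ℂ A] : A →ₗ[ℂ] A →ₗ[ℂ] B2 A :=
  LinearMap.mk₂ ℂ (fun a b => (L3sub A).mkQ ⟨a * b - b * a, commutator_mem_lcs_one a b⟩)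
    (fun a a' b => by
      rw [← map_add]; congr 1; ext; simp only [Submodule.coe_add]; noncomm_ring)
    (fun r a b => by
      rw [← map_smul]; congr 1; ext; simp [smul_sub])
    (fun a b b' => by
      rw [← map_add]; congr 1; ext; simp only [Submodule.coe_add]; noncomm_ring)
    (fun r a b => by
      rw [← map_smul]; congr 1; ext; simp [smul_sub])

theorem commPairing_apply {A : Type} [Ring A] [Algebra ℂ A] (a b : A) :
    commPairing A a b = (L3sub A).mkQ ⟨a * b - b * a, commutator_mem_lcs_one a b⟩ := rfl

theorem isCyclicPairing_commPairing (A : Type) [Ring A] [Algebra ℂ A] :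
    IsCyclicPairing (commPairing A) where
  skew a b := by
    simp only [commPairing_apply]
    rw [← map_neg]; congr 1; ext; simp
  cyclic a b c := by
    simp only [commPairing_apply]
    rw [← map_add, ← map_add, ← map_zero (L3sub A).mkQ]
    congr 1; ext; simp only [Submodule.coe_add, Submodule.coe_zero]; noncomm_ring
  comm_right a b c := by
    rw [commPairing_apply, Submodule.mkQ_apply, Submodule.Quotient.mk_eq_zero]
    exact Submodule.subset_span ⟨a, _, commutator_mem_lcs_one b c, rfl⟩

theorem eq_top_of_commPairing_mem {A : Type} [Ring A] [Algebra ℂ A] {N : Submodule ℂ (B2 A)}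
    (hN : ∀ a b : A, commPairing A a b ∈ N) : N = ⊤ := by
  rw [eq_top_iff]
  rintro b -
  obtain ⟨⟨u, hu⟩, rfl⟩ := Submodule.Quotient.mk_surjective _ b
  have hle : lcs A 1 ≤ (N.comap (L3sub A).mkQ).map (lcs A 1).subtype := by
    refine Submodule.span_le.2 ?_
    rintro _ ⟨a, v, -, rfl⟩
    exact ⟨⟨_, commutator_mem_lcs_one a v⟩, hN a v, rfl⟩
  obtain ⟨v, hv, hvu⟩ := hle hu
  have huv : v = ⟨u, hu⟩ := Subtype.ext hvu
  exact huv ▸ hv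

/-- the classes of the commutators [xⁱ, yʲ] with i, j ≥ 1 span
B₂(ℂ⟨x,y⟩) as a ℂ-vector space; equivalently, every element of L₂(ℂ⟨x,y⟩) is congruent
modulo L₃(ℂ⟨x,y⟩) to a finite ℂ-linear combination of such commutators. -/
theorem stmt12 :
    Submodule.span ℂ
      {b : B2 F2 | ∃ i j : ℕ, 1 ≤ i ∧ 1 ≤ j ∧
        ∃ h : (FreeAlgebra.ι ℂ (0 : Fin 2)) ^ i * (FreeAlgebra.ι ℂ (1 : Fin 2)) ^ j
              - (FreeAlgebra.ι ℂ (1 : Fin 2)) ^ j * (FreeAlgebra.ι ℂ (0 : Fin 2)) ^ i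
                ∈ lcs F2 1,
          b = Submodule.Quotient.mk (p := L3sub F2) ⟨_, h⟩} = ⊤ := by
  refine eq_top_of_commPairing_mem fun a b => ?_
  refine (isCyclicPairing_commPairing F2).apply_mem (fun i j hi hj => ?_) a b
  exact Submodule.subset_span ⟨i, j, hi, hj, commutator_mem_lcs_one _ _, rfl⟩
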